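/- arXiv:1504.01993 — 2 statements merged into one kernel-verified Lean document; each statement's English description precedes it below -/
import Mathlib

section
/- Let C1, C2, C3 be chain complexes over F2, f1 : C1 → C2 and f2 : C2 → C3 chain maps, and H1 a chain nullhomotopy of f2 ∘ f1. If the homology of the iterated mapping cone C (with underlying space C3 ⊕ C2 ⊕ C1 and differential given by the block matrix with rows (∂3, f2, H1), (0, ∂2, f1), (0, 0, ∂1)) is trivial, then there exists a map F3 : H(C3) → H(C1) such that the triangle H(C1) → H(C2) → H(C3) → H(C1), with the first two maps induced by f1 and f2 and the third map F3, is exact at every vertex. -/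
open LinearMap

/-- The homology of a differential `d : C → C`: cycles modulo boundaries. -/
abbrev Hmlg {C : Type} [AddCommGroup C] [Module (ZMod 2) C]
    (d : C →ₗ[ZMod 2] C) : Type :=
  ↥(ker d) ⧸ (Submodule.comap (ker d).subtype (range d))

/-- The homology class of a cycle. -/
abbrev hcls {C : Type} [AddCommGroup C] [Module (ZMod 2) C]
    (d : C →ₗ[ZMod 2] C) (x : C) (hx : x ∈ ker d) : Hmlg d :=
  Submodule.Quotient.mk ⟨x, hx⟩

/-- triangle detection. Given chain complexes `(Cᵢ, dᵢ)` over `F₂`,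
chain maps `f₁ : C₁ → C₂`, `f₂ : C₂ → C₃` and a nullhomotopy `H₁` of `f₂ ∘ f₁`, if the
homology of the iterated mapping cone (with differential `D` in block form
`(d₃, f₂, H₁; 0, d₂, f₁; 0, 0, d₁)`) is trivial, then there is a map
`F₃ : H(C₃) → H(C₁)` making the triangle `H(C₁) → H(C₂) → H(C₃) → H(C₁)` exact at
every vertex, where the first two maps are induced by `f₁` and `f₂`. -/
theorem triangle_detection
    {C1 C2 C3 : Type} [AddCommGroup C1] [Module (ZMod 2) C1]
    [AddCommGroup C2] [Module (ZMod 2) C2]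
    [AddCommGroup C3] [Module (ZMod 2) C3]
    (d1 : C1 →ₗ[ZMod 2] C1) (d2 : C2 →ₗ[ZMod 2] C2) (d3 : C3 →ₗ[ZMod 2] C3)
    (hd1 : d1 ∘ₗ d1 = 0) (hd2 : d2 ∘ₗ d2 = 0) (hd3 : d3 ∘ₗ d3 = 0)
    (f1 : C1 →ₗ[ZMod 2] C2) (f2 : C2 →ₗ[ZMod 2] C3)
    (hf1 : d2 ∘ₗ f1 = f1 ∘ₗ d1) (hf2 : d3 ∘ₗ f2 = f2 ∘ₗ d2)
    (H1 : C1 →ₗ[ZMod 2] C3)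
    (hH1 : d3 ∘ₗ H1 + H1 ∘ₗ d1 = f2 ∘ₗ f1)
    -- the differential of the iterated mapping cone
    (D : C3 × C2 × C1 →ₗ[ZMod 2] C3 × C2 × C1)
    (hD : ∀ x : C3 × C2 × C1,
      D x = (d3 x.1 + f2 x.2.1 + H1 x.2.2, d2 x.2.1 + f1 x.2.2, d1 x.2.2))
    -- the homology of the iterated mapping cone is trivial
    (hacyclic : ∀ x : C3 × C2 × C1, D x = 0 → ∃ y, D y = x)
    -- the maps induced by `f₁` and `f₂` on homology
    (φ1 : Hmlg d1 →ₗ[ZMod 2] Hmlg d2) (φ2 : Hmlg d2 →ₗ[ZMod 2] Hmlg d3)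
    (hφ1 : ∀ (x : C1) (hx : x ∈ ker d1) (hx2 : f1 x ∈ ker d2),
      φ1 (hcls d1 x hx) = hcls d2 (f1 x) hx2)
    (hφ2 : ∀ (x : C2) (hx : x ∈ ker d2) (hx2 : f2 x ∈ ker d3),
      φ2 (hcls d2 x hx) = hcls d3 (f2 x) hx2) :
    ∃ F3 : Hmlg d3 →ₗ[ZMod 2] Hmlg d1,
      ker φ2 = range φ1 ∧ ker F3 = range φ2 ∧ ker φ1 = range F3 := by
  have e1 : ∀ x, d1 (d1 x) = 0 := fun x => LinearMap.congr_fun hd1 x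
  have e2 : ∀ x, d2 (d2 x) = 0 := fun x => LinearMap.congr_fun hd2 x
  have e3 : ∀ x, d3 (d3 x) = 0 := fun x => LinearMap.congr_fun hd3 x
  have g1 : ∀ x, d2 (f1 x) = f1 (d1 x) := fun x => LinearMap.congr_fun hf1 x
  have g2 : ∀ x, d3 (f2 x) = f2 (d2 x) := fun x => LinearMap.congr_fun hf2 x
  have h1 : ∀ x, d3 (H1 x) + H1 (d1 x) = f2 (f1 x) := fun x => LinearMap.congr_fun hH1 x
  have n1 : ∀ x : C1, x + x = 0 := ZModModule.add_self
  have n2 : ∀ x : C2, x + x = 0 := ZModModule.add_self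
  have n3 : ∀ x : C3, x + x = 0 := ZModModule.add_self
  have cls0 : ∀ {C : Type} [AddCommGroup C] [Module (ZMod 2) C] (d : C →ₗ[ZMod 2] C) (x : C)
      (hx : x ∈ ker d), hcls d x hx = 0 ↔ ∃ y, d y = x := by
    intro C _ _ d x hx
    rw [hcls, Submodule.Quotient.mk_eq_zero]
    rfl
  have clseq : ∀ {C : Type} [AddCommGroup C] [Module (ZMod 2) C] (d : C →ₗ[ZMod 2] C) (x x' : C)
      (hx : x ∈ ker d) (hx' : x' ∈ ker d), hcls d x hx = hcls d x' hx' ↔ ∃ y, d y = x - x' := by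
    intro C _ _ d x x' hx hx'
    rw [hcls, hcls, Submodule.Quotient.eq]
    rfl
  have sur : ∀ {C : Type} [AddCommGroup C] [Module (ZMod 2) C] (d : C →ₗ[ZMod 2] C) (q : Hmlg d),
      ∃ x, ∃ hx : x ∈ ker d, hcls d x hx = q := by
    intro C _ _ d q
    obtain ⟨⟨x, hx⟩, rfl⟩ := Submodule.Quotient.mk_surjective _ q
    exact ⟨x, hx, rfl⟩
  -- the key well-definedness fact
  have key : ∀ a b c w, D (a, b, c) = (d3 w, 0, 0) → ∃ y, d1 y = c := by
    intro a b c w h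
    obtain ⟨⟨u, v, y⟩, hy⟩ := hacyclic (a - w, b, c) (by
      have hw : D (w, 0, 0) = (d3 w, 0, 0) := by simp [hD]
      have : ((a - w, b, c) : C3 × C2 × C1) = (a, b, c) - (w, 0, 0) := by simp
      rw [this, map_sub, h, hw, sub_self])
    rw [hD] at hy
    exact ⟨y, congrArg (fun t => t.2.2) hy⟩
  have ex : ∀ z : ker d3, ∃ c : ker d1, ∃ a b, D (a, b, c.1) = (z.1, 0, 0) := by
    rintro ⟨z, hz⟩
    obtain ⟨⟨a, b, c⟩, h⟩ := hacyclic (z, 0, 0) (by rw [hD]; simpa using hz)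
    refine ⟨⟨c, ?_⟩, a, b, h⟩
    rw [hD] at h
    exact congrArg (fun t => t.2.2) h
  choose γ α β hγ using ex
  let G : ker d3 →ₗ[ZMod 2] Hmlg d1 := AddMonoidHom.toZModLinearMap 2
    (AddMonoidHom.mk' (fun z => hcls d1 (γ z).1 (γ z).2) (by
      intro z z'
      show hcls d1 (γ (z + z')).1 (γ (z + z')).2
        = hcls d1 ((γ z).1 + (γ z').1) (add_mem (γ z).2 (γ z').2)
      rw [clseq]
      refine key (α (z + z') - (α z + α z')) (β (z + z') - (β z + β z')) _ 0 ?_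
      have := congrArg₂ (· - ·) (hγ (z + z')) (congrArg₂ (· + ·) (hγ z) (hγ z'))
      simp only [← map_add, ← map_sub] at this
      refine Eq.trans (by simpa using this) (rfl : (0 : C3 × C2 × C1) = _) |>.trans (by rw [map_zero]; rfl)))
  have Gdef : ∀ z, G z = hcls d1 (γ z).1 (γ z).2 := fun z => rfl
  let F : Hmlg d3 →ₗ[ZMod 2] Hmlg d1 := Submodule.liftQ _ G (by
    rintro z ⟨w, hw⟩
    rw [LinearMap.mem_ker, Gdef, cls0]
    refine key (α z) (β z) _ w ?_
    rw [hγ, hw]; rfl)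
  have Fdef : ∀ z hz a b c (hc : c ∈ ker d1), D (a, b, c) = (z, 0, 0) →
      F (hcls d3 z hz) = hcls d1 c hc := by
    intro z hz a b c hc h
    show hcls d1 (γ ⟨z, hz⟩).1 (γ ⟨z, hz⟩).2 = _
    rw [clseq]
    refine key (α ⟨z, hz⟩ - a) (β ⟨z, hz⟩ - b) _ 0 ?_
    have := congrArg₂ (· - ·) (hγ ⟨z, hz⟩) h
    simp only [← map_sub] at this
    refine Eq.trans (by simpa using this) (rfl : (0 : C3 × C2 × C1) = _) |>.trans (by rw [map_zero]; rfl)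
  have k1 : ∀ c, c ∈ ker d1 → f1 c ∈ ker d2 := by
    intro c hc
    rw [LinearMap.mem_ker] at *
    rw [g1, hc, map_zero]
  have k2 : ∀ c, c ∈ ker d2 → f2 c ∈ ker d3 := by
    intro c hc
    rw [LinearMap.mem_ker] at *
    rw [g2, hc, map_zero]
  have Dc : ∀ a b c z, D (a, b, c) = (z, 0, 0) ↔
      d3 a + f2 b + H1 c = z ∧ d2 b + f1 c = 0 ∧ d1 c = 0 := by
    intro a b c z
    rw [hD]; simp
  refine ⟨F, ?_, ?_, ?_⟩
  · ext q
    obtain ⟨b, hb, rfl⟩ := sur d2 q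
    rw [LinearMap.mem_ker, hφ2 b hb (k2 b hb), cls0]
    constructor
    · rintro ⟨a, ha⟩
      obtain ⟨⟨x, y, c⟩, h⟩ := hacyclic (-a, b, 0) (by
        rw [hD]
        have hb' : d2 b = 0 := hb
        simp [ha, hb'])
      rw [hD] at h
      simp only [Prod.mk.injEq] at h
      obtain ⟨-, h2, h3⟩ := h
      refine ⟨hcls d1 c h3, ?_⟩
      rw [hφ1 c h3 (k1 c h3), clseq]
      refine ⟨-y, ?_⟩
      rw [← h2, map_neg]; abel
    · rintro ⟨p, hp⟩
      obtain ⟨c, hc, rfl⟩ := sur d1 p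
      rw [hφ1 c hc (k1 c hc), clseq] at hp
      obtain ⟨y, hy⟩ := hp
      refine ⟨H1 c - f2 y, ?_⟩
      have hc' : d1 c = 0 := hc
      have := h1 c
      rw [hc', map_zero, add_zero] at this
      rw [map_sub, g2, hy, this, map_sub]; abel
  · ext q
    obtain ⟨z, hz, rfl⟩ := sur d3 q
    rw [LinearMap.mem_ker]
    constructor
    · intro h
      obtain ⟨c, a, b, h'⟩ : ∃ c : ker d1, ∃ a b, D (a, b, c.1) = (z, 0, 0) :=
        ⟨_, _, _, hγ ⟨z, hz⟩⟩
      rw [Fdef z hz a b c.1 c.2 h', cls0] at h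
      obtain ⟨e, he⟩ := h
      rw [Dc] at h'
      obtain ⟨p1, p2, p3⟩ := h'
      have hk : b + f1 e ∈ ker d2 := by
        rw [LinearMap.mem_ker, map_add, g1, he, p2]
      refine ⟨hcls d2 _ hk, ?_⟩
      rw [hφ2 _ hk (k2 _ hk), clseq]
      refine ⟨H1 e - a, ?_⟩
      have := h1 e
      rw [he] at this
      rw [← p1, map_add, ← this, map_sub]
      have := n3 (H1 c.1)
      abel
    · rintro ⟨p, hp⟩
      obtain ⟨b, hb, rfl⟩ := sur d2 p
      rw [hφ2 b hb (k2 b hb), clseq] at hp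
      obtain ⟨w, hw⟩ := hp
      rw [Fdef z hz (-w) b 0 (zero_mem _) ?_, cls0]
      · exact ⟨0, map_zero _⟩
      · rw [Dc]
        have hb' : d2 b = 0 := hb
        refine ⟨?_, by simp [hb'], map_zero _⟩
        rw [map_neg, hw, map_zero]; abel
  · ext q
    obtain ⟨c, hc, rfl⟩ := sur d1 q
    rw [LinearMap.mem_ker, hφ1 c hc (k1 c hc), cls0]
    have hc' : d1 c = 0 := hc
    constructor
    · rintro ⟨b, hb⟩
      have hz : f2 b + H1 c ∈ ker d3 := by
        have := h1 c
        rw [hc', map_zero, add_zero] at this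
        rw [LinearMap.mem_ker, map_add, g2, hb, this, n3]
      refine ⟨hcls d3 _ hz, Fdef _ hz 0 b c hc ?_⟩
      rw [Dc]
      exact ⟨by simp, by rw [hb, n2], hc'⟩
    · rintro ⟨p, hp⟩
      obtain ⟨z, hz, rfl⟩ := sur d3 p
      obtain ⟨c', a, b, h'⟩ : ∃ c : ker d1, ∃ a b, D (a, b, c.1) = (z, 0, 0) :=
        ⟨_, _, _, hγ ⟨z, hz⟩⟩
      rw [Fdef z hz a b c'.1 c'.2 h', clseq] at hp
      obtain ⟨y, hy⟩ := hp
      rw [Dc] at h'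
      refine ⟨-b - f1 y, ?_⟩
      rw [map_sub, map_neg, g1, hy, map_sub, eq_neg_of_add_eq_zero_left h'.2.1]; abel
end

section
/- Let S be a graded F2-vector space with an exact triangle S →^{e} S →^{ι} M →^{π} S (degrees −1, 0, 0) where M is concentrated in even degrees and eventually standard. If in degrees 4N ≤ i ≤ 4N+3 the triangle contains a 'standard copy' generated by elements v, qv, q²v of S in degrees 4N+2(?), then the ranks dim S_{4N−1} form a non-decreasing sequence in N once the standard copy propagates downward under multiplication by V; consequently if dim S_{4N−1} = 0 for N large, then dim S_{4N−1} = 0 for all N ≥ 1. -/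
/-- Homogeneous preimages under a degree `-1` map. -/
theorem gysin_homog_preimage
    {SS : Type} [AddCommGroup SS] [Module (ZMod 2) SS]
    (gS : ℤ → Submodule (ZMod 2) SS)
    (hS : DirectSum.IsInternal gS)
    (eMap : SS →ₗ[ZMod 2] SS)
    (hedeg : ∀ i, (gS i).map eMap ≤ gS (i - 1))
    (j : ℤ) (x : SS) (hy : eMap x ∈ gS (j - 1)) :
    ∃ x' ∈ gS j, eMap x' = eMap x := by
  have htop : x ∈ gS j ⊔ ⨆ (i) (_ : i ≠ j), gS i := by
    have h : (⨆ i, gS i) ≤ gS j ⊔ ⨆ (i) (_ : i ≠ j), gS i := by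
      refine iSup_le fun i => ?_
      by_cases hij : i = j
      · subst hij; exact le_sup_left
      · exact le_sup_of_le_right (le_iSup₂_of_le i hij le_rfl)
    rw [hS.submodule_iSup_eq_top] at h
    exact h Submodule.mem_top
  obtain ⟨x', hx', r, hr, rfl⟩ := Submodule.mem_sup.1 htop
  refine ⟨x', hx', ?_⟩
  have h1 : eMap r ∈ ⨆ (k) (_ : k ≠ j - 1), gS k := by
    have h : (⨆ (i) (_ : i ≠ j), gS i) ≤
        (⨆ (k) (_ : k ≠ j - 1), gS k).comap eMap := by
      refine iSup₂_le fun i hi => ?_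
      rw [← Submodule.map_le_iff_le_comap]
      exact (hedeg i).trans (le_iSup₂_of_le (i - 1) (by omega) le_rfl)
    exact h hr
  have h2 : eMap r ∈ gS (j - 1) := by
    have h3 := (gS (j - 1)).sub_mem hy (hedeg j (Submodule.mem_map_of_mem hx'))
    simpa using h3
  have h0 : eMap r = 0 :=
    Submodule.disjoint_def.1 (hS.submodule_iSupIndep (j - 1)) _ h2 h1
  rw [map_add, h0, add_zero]

/-- `dim S_{j-1} ≤ dim S_j + dim M_{j-1}`. -/
theorem gysin_finrank_step
    {SS MM : Type} [AddCommGroup SS] [Module (ZMod 2) SS]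
    [AddCommGroup MM] [Module (ZMod 2) MM]
    (gS : ℤ → Submodule (ZMod 2) SS) (gM : ℤ → Submodule (ZMod 2) MM)
    (hS : DirectSum.IsInternal gS)
    (hSfin : ∀ i, FiniteDimensional (ZMod 2) ↥(gS i))
    (hMfin : ∀ i, FiniteDimensional (ZMod 2) ↥(gM i))
    (eMap : SS →ₗ[ZMod 2] SS) (iMap : SS →ₗ[ZMod 2] MM)
    (hedeg : ∀ i, (gS i).map eMap ≤ gS (i - 1))
    (hideg : ∀ i, (gS i).map iMap ≤ gM i)
    (hexact1 : Function.Exact ⇑eMap ⇑iMap) (j : ℤ) :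
    Module.finrank (ZMod 2) ↥(gS (j - 1)) ≤
      Module.finrank (ZMod 2) ↥(gS j) + Module.finrank (ZMod 2) ↥(gM (j - 1)) := by
  have := hSfin
  have := hMfin
  let f : gS (j - 1) →ₗ[ZMod 2] gM (j - 1) :=
    iMap.restrict fun x hx => hideg _ (Submodule.mem_map_of_mem hx)
  let g : gS j →ₗ[ZMod 2] gS (j - 1) :=
    eMap.restrict fun x hx => hedeg _ (Submodule.mem_map_of_mem hx)
  have hker : LinearMap.ker f ≤ LinearMap.range g := by
    rintro ⟨y, hy⟩ hfy
    have h0 : iMap y = 0 := congrArg Subtype.val (LinearMap.mem_ker.1 hfy)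
    obtain ⟨x, rfl⟩ := (hexact1 y).1 h0
    obtain ⟨x', hx', h⟩ := gysin_homog_preimage gS hS eMap hedeg j x hy
    exact ⟨⟨x', hx'⟩, Subtype.ext h⟩
  have h1 := LinearMap.finrank_range_add_finrank_ker f
  have h2 := Submodule.finrank_mono hker
  have h3 := LinearMap.finrank_range_le g
  have h4 := Submodule.finrank_le (LinearMap.range f)
  omega


/-- monotonicity step in the Gysin uniqueness proof. Consider an
abstract Gysin sequence `... → S_j →^ι M_j →^π S_j →^e S_{j-1} → ...` of graded
`F₂`-vector spaces in which `M` is concentrated in even degrees (and eventually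
standard: one-dimensional in high even degrees).  If the sequence is increasing at
level `4N` for every `N ≥ 1` (in the sense of the increasing/decreasing dichotomy:
`dim S_{4N+1} = dim S_{4N} = dim S_{4N-1} + 1` and `π` injective on `M_{4N}`), then
`N ↦ dim S_{4N-1}` is non-decreasing; consequently, if `S_{4N-1} = 0` for all large
`N`, then `S_{4N-1} = 0` for every `N ≥ 1`. -/
theorem gysin_rank_monotonicity
    {SS MM : Type} [AddCommGroup SS] [Module (ZMod 2) SS]
    [AddCommGroup MM] [Module (ZMod 2) MM]
    (gS : ℤ → Submodule (ZMod 2) SS) (gM : ℤ → Submodule (ZMod 2) MM)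
    (hSinternal : DirectSum.IsInternal gS)
    (hMinternal : DirectSum.IsInternal gM)
    (hSfin : ∀ i, FiniteDimensional (ZMod 2) ↥(gS i))
    (hMfin : ∀ i, FiniteDimensional (ZMod 2) ↥(gM i))
    (eMap : SS →ₗ[ZMod 2] SS) (iMap : SS →ₗ[ZMod 2] MM) (pMap : MM →ₗ[ZMod 2] SS)
    (hedeg : ∀ i, (gS i).map eMap ≤ gS (i - 1))
    (hideg : ∀ i, (gS i).map iMap ≤ gM i)
    (hpdeg : ∀ i, (gM i).map pMap ≤ gS i)
    (hexact1 : Function.Exact ⇑eMap ⇑iMap)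
    (hexact2 : Function.Exact ⇑iMap ⇑pMap)
    (hexact3 : Function.Exact ⇑pMap ⇑eMap)
    -- `M` is concentrated in even degrees, and eventually standard
    (hModd : ∀ i : ℤ, Odd i → 1 ≤ i → gM i = ⊥)
    (hMone : ∀ i : ℤ, 2 ≤ i → Module.finrank (ZMod 2) ↥(gM i) ≤ 1)
    -- the sequence is increasing at level `4N` for every `N ≥ 1`
    (hincr : ∀ N : ℤ, 1 ≤ N →
      Module.finrank (ZMod 2) ↥(gS (4 * N + 1)) = Module.finrank (ZMod 2) ↥(gS (4 * N)) ∧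
      Module.finrank (ZMod 2) ↥(gS (4 * N)) = Module.finrank (ZMod 2) ↥(gS (4 * N - 1)) + 1 ∧
      (∀ x ∈ gM (4 * N), pMap x = 0 → x = 0)) :
    -- `N ↦ dim S_{4N-1}` is non-decreasing ...
    (∀ N N' : ℤ, 1 ≤ N → N ≤ N' →
      Module.finrank (ZMod 2) ↥(gS (4 * N - 1)) ≤ Module.finrank (ZMod 2) ↥(gS (4 * N' - 1))) ∧
    -- ... hence eventual vanishing forces vanishing for all `N ≥ 1`
    ((∃ N0 : ℤ, ∀ N ≥ N0, gS (4 * N - 1) = ⊥) →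
      ∀ N : ℤ, 1 ≤ N → gS (4 * N - 1) = ⊥) := by
  have key := gysin_finrank_step gS gM hSinternal hSfin hMfin eMap iMap hedeg hideg hexact1
  have step : ∀ N : ℤ, 1 ≤ N → Module.finrank (ZMod 2) ↥(gS (4 * N - 1)) ≤
      Module.finrank (ZMod 2) ↥(gS (4 * (N + 1) - 1)) := by
    intro N hN
    obtain ⟨ha, hb, -⟩ := hincr N hN
    have k1 := key (4 * N + 2)
    have k2 := key (4 * N + 3)
    have e1 : 4 * N + 2 - 1 = 4 * N + 1 := by ring
    have e2 : 4 * N + 3 - 1 = 4 * N + 2 := by ring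
    have e3 : 4 * (N + 1) - 1 = 4 * N + 3 := by ring
    rw [e1, hModd (4 * N + 1) ⟨2 * N, by ring⟩ (by omega), finrank_bot] at k1
    rw [e2] at k2
    have k3 := hMone (4 * N + 2) (by omega)
    rw [e3]
    omega
  have mono : ∀ N N' : ℤ, 1 ≤ N → N ≤ N' →
      Module.finrank (ZMod 2) ↥(gS (4 * N - 1)) ≤
        Module.finrank (ZMod 2) ↥(gS (4 * N' - 1)) := by
    intro N N' hN hNN'
    induction N', hNN' using Int.leInduction with
    | base => exact le_rfl
    | succ n hn ih => exact ih.trans (step n (by omega))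
  refine ⟨mono, ?_⟩
  rintro ⟨N0, h0⟩ N hN
  have h := mono N (max N N0) hN (le_max_left _ _)
  rw [h0 _ (le_max_right _ _), finrank_bot] at h
  have := hSfin (4 * N - 1)
  exact Submodule.finrank_eq_zero.1 (Nat.le_zero.1 h)
end
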